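/- arXiv:math/0405167 — 8 statements merged into one kernel-verified Lean document; each statement's English description precedes it below -/
import Mathlib

section
/- Let v : ℝ^N → [0,∞) be lower semicontinuous and assume that for every x ∈ ℝ^N∖{0} and every (p,Y) ∈ J^{2,−}v(x) there exists ᾱ ∈ A with σ(x,ᾱ)^T p = 0 and −p·f(x,ᾱ) − trace(a(x,ᾱ)Y) ≥ 0. Let φ : ℝ → ℝ be twice continuously differentiable with φ′(t) > 0 for all t. Then w := φ ∘ v satisfies: for every x ∈ ℝ^N∖{0} and every (p,Y) ∈ J^{2,−}w(x), sup_{α∈A} { −p·f(x,α) − trace(a(x,α)Y) } ≥ 0; that is, w is a viscosity supersolution of max_{α∈A}{ −Dw·f(x,α) − trace(a(x,α)D²w) } = 0 on ℝ^N∖{0}. -/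
open scoped BigOperators

noncomputable section

/-- Euclidean dot product on `ℝ^N`. -/
def dotP {N : ℕ} (p q : EuclideanSpace ℝ (Fin N)) : ℝ := ∑ i, p i * q i

/-- Quadratic form `v ⬝ (Y v)` of an `N × N` matrix. -/
def quadF {N : ℕ} (Y : Matrix (Fin N) (Fin N) ℝ) (v : EuclideanSpace ℝ (Fin N)) : ℝ :=
  ∑ i, v i * ∑ j, Y i j * v j

/-- Second-order subjet `J^{2,-}V(x)`: pairs `(p,Y)` with `Y` symmetric such that
`V(y) ≥ V(x) + p·(y-x) + (1/2)(y-x)·Y(y-x) + o(|y-x|²)` as `y → x`. -/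
def InSubjet {N : ℕ} (V : EuclideanSpace ℝ (Fin N) → ℝ)
    (x p : EuclideanSpace ℝ (Fin N)) (Y : Matrix (Fin N) (Fin N) ℝ) : Prop :=
  Y.IsSymm ∧ ∀ ε > 0, ∃ δ > 0, ∀ y : EuclideanSpace ℝ (Fin N), ‖y - x‖ < δ →
    V y ≥ V x + dotP p (y - x) + (1/2) * quadF Y (y - x) - ε * ‖y - x‖ ^ 2

/-- The diffusion matrix `a = (1/2) σ σᵀ`. -/
def aMat {N M : ℕ} (σ : Matrix (Fin N) (Fin M) ℝ) : Matrix (Fin N) (Fin N) ℝ :=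
  (1/2 : ℝ) • (σ * σ.transpose)

open Asymptotics Filter Topology Matrix

lemma dotP_smul_left {N : ℕ} (c : ℝ) (p q : EuclideanSpace ℝ (Fin N)) :
    dotP (c • p) q = c * dotP p q := by
  simp [dotP, Finset.mul_sum, mul_assoc]

lemma quadF_sub_smul_vecMulVec {N : ℕ} (Y : Matrix (Fin N) (Fin N) ℝ) (a b : ℝ)
    (p h : EuclideanSpace ℝ (Fin N)) :
    quadF (a • Y - b • vecMulVec p p) h = a * quadF Y h - b * dotP p h ^ 2 := by
  have h1 : dotP p h ^ 2 = ∑ i, h i * ∑ j, p i * p j * h j := by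
    rw [sq]
    simp only [dotP]
    rw [Finset.sum_mul]
    refine Finset.sum_congr rfl fun i _ => ?_
    rw [Finset.mul_sum, Finset.mul_sum]
    refine Finset.sum_congr rfl fun j _ => ?_
    ring
  rw [h1]
  simp only [quadF, Finset.mul_sum, ← Finset.sum_sub_distrib, Matrix.sub_apply, Matrix.smul_apply,
    smul_eq_mul, vecMulVec_apply]
  refine Finset.sum_congr rfl fun i _ => Finset.sum_congr rfl fun j _ => ?_
  ring

lemma coord_isBigO {N : ℕ} (l : Filter (EuclideanSpace ℝ (Fin N))) (i : Fin N) :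
    (fun h : EuclideanSpace ℝ (Fin N) => h i) =O[l] fun h => ‖h‖ :=
  IsBigO.of_bound 1 (Eventually.of_forall fun h => by
    simpa using PiLp.norm_apply_le h i)

lemma dotP_isBigO {N : ℕ} (l : Filter (EuclideanSpace ℝ (Fin N)))
    (p : EuclideanSpace ℝ (Fin N)) : (fun h => dotP p h) =O[l] fun h => ‖h‖ :=
  IsBigO.fun_sum fun i _ => (coord_isBigO l i).const_mul_left _

lemma quadF_isBigO {N : ℕ} (l : Filter (EuclideanSpace ℝ (Fin N)))
    (Y : Matrix (Fin N) (Fin N) ℝ) : (fun h => quadF Y h) =O[l] fun h => ‖h‖ ^ 2 := by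
  simp only [sq]
  exact IsBigO.fun_sum fun i _ => (coord_isBigO l i).mul <|
    IsBigO.fun_sum fun j _ => (coord_isBigO l j).const_mul_left _

/-- Second-order Taylor expansion of a `C²` function of one real variable. -/
lemma ContDiff.taylor_two_isLittleO {φ : ℝ → ℝ} (hφ : ContDiff ℝ 2 φ) (t : ℝ) :
    (fun s => φ (t + s) - φ t - deriv φ t * s - iteratedDeriv 2 φ t / 2 * s ^ 2)
      =o[𝓝 0] fun s => s ^ 2 := by
  have h := taylor_isLittleO_univ (n := 2) (x₀ := t) hφ
  have ht : Tendsto (fun s : ℝ => t + s) (𝓝 0) (𝓝 t) := by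
    have : Continuous fun s : ℝ => t + s := by fun_prop
    simpa using this.tendsto 0
  refine (h.comp_tendsto ht).congr (fun s => ?_) (fun s => by simp)
  simp only [Function.comp_apply, taylor_within_apply, Finset.sum_range_succ,
    iteratedDerivWithin_univ, Finset.range_zero, Finset.sum_empty, iteratedDeriv_zero,
    iteratedDeriv_one, Nat.factorial, smul_eq_mul]
  push_cast
  ring

/-- A `C²` function applied to a quadratic expansion, up to second order. -/
lemma ContDiff.comp_quadratic_isLittleO {E : Type*} [SeminormedAddCommGroup E] {φ : ℝ → ℝ}
    (hφ : ContDiff ℝ 2 φ) (t : ℝ) {q r : E → ℝ}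
    (hq : q =O[𝓝 0] fun h => ‖h‖) (hr : r =O[𝓝 0] fun h => ‖h‖ ^ 2) :
    (fun h => φ (t + (q h + r h)) - φ t - deriv φ t * (q h + r h)
      - iteratedDeriv 2 φ t / 2 * q h ^ 2) =o[𝓝 0] fun h : E => ‖h‖ ^ 2 := by
  have hn : Tendsto (fun h : E => ‖h‖) (𝓝 0) (𝓝 0) := tendsto_norm_zero
  have hsq : (fun h : E => ‖h‖ ^ 2) =o[𝓝 0] fun h : E => ‖h‖ := by
    have := (isLittleO_pow_pow (𝕜 := ℝ) (m := 1) (n := 2) (by norm_num)).comp_tendsto hn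
    simpa [Function.comp_def] using this
  have hro : r =o[𝓝 0] fun h : E => ‖h‖ := hr.trans_isLittleO hsq
  have hE : (fun h => q h + r h) =O[𝓝 0] fun h : E => ‖h‖ := hq.add hro.isBigO
  have hE0 : Tendsto (fun h => q h + r h) (𝓝 0) (𝓝 0) := hE.trans_tendsto hn
  have h1 := ((hφ.taylor_two_isLittleO t).comp_tendsto hE0).trans_isBigO (hE.pow 2)
  have h2 : (fun h => r h * (2 * q h + r h)) =o[𝓝 0] fun h : E => ‖h‖ ^ 2 := by
    simp only [sq]
    exact hro.mul_isBigO ((hq.const_mul_left 2).add hro.isBigO)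
  refine (h1.add (h2.const_mul_left (iteratedDeriv 2 φ t / 2))).congr_left fun h => ?_
  simp only [Function.comp_apply]
  ring

/-- Chain rule for second-order subjets: from a subjet element of `φ ∘ v` one recovers one of
`v`, when `φ` is `C²` with positive derivative. -/
lemma InSubjet.of_comp {N : ℕ} {v : EuclideanSpace ℝ (Fin N) → ℝ} {φ : ℝ → ℝ}
    (hφ : ContDiff ℝ 2 φ) (hφ' : ∀ t, 0 < deriv φ t) {x p : EuclideanSpace ℝ (Fin N)}
    {Y : Matrix (Fin N) (Fin N) ℝ} (h : InSubjet (fun y => φ (v y)) x p Y) :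
    InSubjet v x ((deriv φ (v x))⁻¹ • p)
      ((deriv φ (v x))⁻¹ • Y
        - (iteratedDeriv 2 φ (v x) / deriv φ (v x) ^ 3) • vecMulVec p p) := by
  obtain ⟨hY, hsub⟩ := h
  have hmono : StrictMono φ := strictMono_of_deriv_pos hφ'
  set c := deriv φ (v x) with hc
  set d := iteratedDeriv 2 φ (v x) with hd
  have hc0 : 0 < c := hφ' _
  refine ⟨?_, fun ε hε => ?_⟩
  · refine (hY.smul _).sub (IsSymm.smul ?_ _)
    ext i j
    simp [vecMulVec_apply, mul_comm]
  obtain ⟨δ₁, hδ₁, H₁⟩ := hsub (c * ε / 2) (by positivity)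
  have hr : (fun k => 1 / 2 * quadF (c⁻¹ • Y - (d / c ^ 3) • vecMulVec p p) k - ε * ‖k‖ ^ 2)
      =O[𝓝 0] fun k => ‖k‖ ^ 2 :=
    ((quadF_isBigO _ _).const_mul_left _).sub ((isBigO_refl _ _).const_mul_left _)
  have key := (hφ.comp_quadratic_isLittleO (v x) (dotP_isBigO _ (c⁻¹ • p)) hr).def
    (c := c * ε / 2) (by positivity)
  obtain ⟨δ₂, hδ₂, H₂⟩ := Metric.eventually_nhds_iff.1 key
  refine ⟨min δ₁ δ₂, lt_min hδ₁ hδ₂, fun y hy => ?_⟩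
  have h₁ := H₁ y (hy.trans_le (min_le_left _ _))
  have h₂ := H₂ (y := y - x) (by simpa using hy.trans_le (min_le_right _ _))
  rw [← hc, ← hd] at h₂
  generalize y - x = k at h₁ h₂ ⊢
  by_contra! hlt
  have h₃ := hmono hlt
  rw [add_sub_assoc, add_assoc] at h₃
  have h₄ := (abs_le.1 h₂).2
  rw [Real.norm_of_nonneg (by positivity)] at h₄
  rw [quadF_sub_smul_vecMulVec, dotP_smul_left] at h₃ h₄
  have e : c * (c⁻¹ * dotP p k + (1 / 2 * (c⁻¹ * quadF Y k - d / c ^ 3 * dotP p k ^ 2)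
      - ε * ‖k‖ ^ 2)) + d / 2 * (c⁻¹ * dotP p k) ^ 2
      = dotP p k + 1 / 2 * quadF Y k - c * ε * ‖k‖ ^ 2 := by
    field_simp
    ring
  have h₅ := lt_of_le_of_lt h₁ h₃
  linarith

lemma aMat_mul_vecMulVec_of_mulVec_eq_zero {N M : ℕ} (σ : Matrix (Fin N) (Fin M) ℝ)
    {p : Fin N → ℝ} (h : σᵀ *ᵥ p = 0) (q : Fin N → ℝ) : aMat σ * vecMulVec p q = 0 := by
  rw [aMat, smul_mul, Matrix.mul_assoc, mul_vecMulVec, h]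
  simp

/-- if a l.s.c. nonnegative `v` satisfies the constrained HJB supersolution
condition, then `w = φ ∘ v` (`φ` a `C²` strictly increasing map) is a viscosity supersolution
of `max_α { -Dw·f - trace(a D²w) } = 0` on `ℝ^N \ {0}`. -/
theorem stmt1 {N M : ℕ} {A : Type*} [MetricSpace A] [CompactSpace A] [Nonempty A]
    (f : EuclideanSpace ℝ (Fin N) → A → EuclideanSpace ℝ (Fin N))
    (σ : EuclideanSpace ℝ (Fin N) → A → Matrix (Fin N) (Fin M) ℝ)
    (hf : Continuous fun q : EuclideanSpace ℝ (Fin N) × A => f q.1 q.2)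
    (hσ : Continuous fun q : EuclideanSpace ℝ (Fin N) × A => σ q.1 q.2)
    (v : EuclideanSpace ℝ (Fin N) → ℝ) (hv0 : ∀ x, 0 ≤ v x)
    (hlsc : LowerSemicontinuous v)
    (hv : ∀ x : EuclideanSpace ℝ (Fin N), x ≠ 0 → ∀ p Y, InSubjet v x p Y →
      ∃ α : A, (σ x α).transpose.mulVec (fun i => p i) = 0 ∧
        0 ≤ -dotP p (f x α) - (aMat (σ x α) * Y).trace)
    (φ : ℝ → ℝ) (hφ : ContDiff ℝ 2 φ) (hφ' : ∀ t, 0 < deriv φ t) :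
    ∀ x : EuclideanSpace ℝ (Fin N), x ≠ 0 → ∀ p Y, InSubjet (fun y => φ (v y)) x p Y →
      0 ≤ ⨆ α : A, (-dotP p (f x α) - (aMat (σ x α) * Y).trace) := by
  intro x hx p Y hpY
  have hc0 : 0 < deriv φ (v x) := hφ' _
  obtain ⟨α, hα, hle⟩ := hv x hx _ _ (hpY.of_comp hφ hφ')
  generalize deriv φ (v x) = c at *
  have hp : (σ x α)ᵀ *ᵥ (fun i => p i) = 0 := by
    have h : (fun i => (c⁻¹ • p) i) = c⁻¹ • fun i => p i := by
      ext i
      simp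
    rw [h, mulVec_smul] at hα
    exact (smul_eq_zero.1 hα).resolve_left (inv_ne_zero hc0.ne')
  have hval : 0 ≤ -dotP p (f x α) - (aMat (σ x α) * Y).trace := by
    rw [Matrix.mul_sub, Matrix.mul_smul, Matrix.mul_smul, aMat_mul_vecMulVec_of_mulVec_eq_zero _ hp,
      smul_zero, sub_zero, trace_smul, dotP_smul_left, smul_eq_mul] at hle
    refine nonneg_of_mul_nonneg_right (a := c⁻¹) ?_ (inv_pos.2 hc0)
    linarith
  have hf' : Continuous fun α => f x α := hf.comp (Continuous.prodMk_right x)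
  have hσ' : Continuous fun α => σ x α := hσ.comp (Continuous.prodMk_right x)
  have hcont : Continuous fun α => -dotP p (f x α) - (aMat (σ x α) * Y).trace := by
    unfold dotP aMat
    fun_prop
  exact le_ciSup_of_le (isCompact_range hcont).bddAbove α hval
end
end

section
/- Let V : ℝ^N → [0,∞) be lower semicontinuous, positive definite (V(0) = 0 and V(x) > 0 for x ≠ 0), continuous at 0, and assume that for every x ∈ ℝ^N∖{0} and every (p,Y) ∈ J^{2,−}V(x) there exists ᾱ ∈ A with σ(x,ᾱ)^T p = 0 and −p·f(x,ᾱ) − trace(a(x,ᾱ)Y) ≥ 0. Then for every μ > 0 the sublevel set K := {x : V(x) ≤ μ} is closed, contains a neighborhood of the origin, and satisfies the Nagumo-type condition: for every x ∈ ∂K and every (p,Y) ∈ N²_K(x) there exists α ∈ A such that f(x,α)·p + trace(a(x,α)Y) ≥ 0. -/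
open scoped BigOperators

noncomputable section

/-- Second order normal cone `N²_K(x)` to a closed set `K` at `x ∈ K`. -/
def InNormalCone {N : ℕ} (K : Set (EuclideanSpace ℝ (Fin N)))
    (x p : EuclideanSpace ℝ (Fin N)) (Y : Matrix (Fin N) (Fin N) ℝ) : Prop :=
  Y.IsSymm ∧ ∀ ε > 0, ∃ δ > 0, ∀ y ∈ K, ‖y - x‖ < δ →
    dotP p (y - x) + (1/2) * quadF Y (y - x) ≥ -(ε * ‖y - x‖ ^ 2)

theorem dotP_eq_dotProduct {N : ℕ} (p q : EuclideanSpace ℝ (Fin N)) :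
    dotP p q = p.ofLp ⬝ᵥ q.ofLp := rfl

theorem quadF_eq_dotProduct {N : ℕ} (Y : Matrix (Fin N) (Fin N) ℝ)
    (v : EuclideanSpace ℝ (Fin N)) : quadF Y v = v.ofLp ⬝ᵥ Y.mulVec v.ofLp := rfl

theorem exists_abs_dotP_le {N : ℕ} (p : EuclideanSpace ℝ (Fin N)) :
    ∃ C, 0 ≤ C ∧ ∀ v, |dotP p v| ≤ C * ‖v‖ := by
  refine ⟨∑ i, |p i|, by positivity, fun v => ?_⟩
  rw [Finset.sum_mul]
  refine (Finset.abs_sum_le_sum_abs _ _).trans (Finset.sum_le_sum fun i _ => ?_)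
  rw [abs_mul]
  gcongr
  exact PiLp.norm_apply_le v i

theorem exists_abs_quadF_le {N : ℕ} (Y : Matrix (Fin N) (Fin N) ℝ) :
    ∃ C, 0 ≤ C ∧ ∀ v, |quadF Y v| ≤ C * ‖v‖ ^ 2 := by
  refine ⟨∑ i, ∑ j, |Y i j|, by positivity, fun v => ?_⟩
  rw [Finset.sum_mul]
  refine (Finset.abs_sum_le_sum_abs _ _).trans (Finset.sum_le_sum fun i _ => ?_)
  rw [abs_mul, pow_two, mul_left_comm, Finset.sum_mul, mul_comm ‖v‖, ← Finset.sum_mul, mul_assoc,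
    mul_comm ‖v‖, ← mul_assoc, mul_comm]
  gcongr
  · rw [Finset.sum_mul]
    refine (Finset.abs_sum_le_sum_abs _ _).trans (Finset.sum_le_sum fun j _ => ?_)
    rw [abs_mul]
    gcongr
    exact PiLp.norm_apply_le v j
  · exact PiLp.norm_apply_le v i

theorem quadF_add {N : ℕ} {Y : Matrix (Fin N) (Fin N) ℝ} (hY : Y.IsSymm)
    (v w : EuclideanSpace ℝ (Fin N)) :
    quadF Y (v + w) = quadF Y v + 2 * dotP (WithLp.toLp 2 (Y.mulVec v.ofLp)) w + quadF Y w := by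
  have h : v.ofLp ⬝ᵥ Y.mulVec w.ofLp = Y.mulVec v.ofLp ⬝ᵥ w.ofLp := by
    rw [Matrix.dotProduct_mulVec, ← Matrix.mulVec_transpose, hY.eq]
  simp only [quadF_eq_dotProduct, dotP_eq_dotProduct, WithLp.ofLp_add, Matrix.mulVec_add,
    add_dotProduct, dotProduct_add, h]
  rw [dotProduct_comm w.ofLp]
  ring

theorem quadF_add_smul_one {N : ℕ} (Y : Matrix (Fin N) (Fin N) ℝ) (c : ℝ)
    (v : EuclideanSpace ℝ (Fin N)) : quadF (Y + c • 1) v = quadF Y v + c * ‖v‖ ^ 2 := by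
  simp only [quadF_eq_dotProduct, Matrix.add_mulVec, Matrix.smul_mulVec, Matrix.one_mulVec,
    dotProduct_add, dotProduct_smul, smul_eq_mul, EuclideanSpace.norm_sq_eq, Real.norm_eq_abs,
    sq_abs]
  simp [dotProduct, pow_two]

theorem quadF_sub_smul_vecMulVec_s5 {N : ℕ} (Z : Matrix (Fin N) (Fin N) ℝ) (c : ℝ)
    (q v : EuclideanSpace ℝ (Fin N)) :
    quadF (Z - c • Matrix.vecMulVec q.ofLp q.ofLp) v = quadF Z v - c * dotP q v ^ 2 := by
  simp only [quadF_eq_dotProduct, dotP_eq_dotProduct, Matrix.sub_mulVec, Matrix.smul_mulVec,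
    Matrix.vecMulVec_mulVec, dotProduct_sub, dotProduct_smul, smul_eq_mul]
  rw [dotProduct_comm v.ofLp q.ofLp, op_smul_eq_smul, smul_eq_mul]
  ring

theorem trace_aMat_mul_vecMulVec {N M : ℕ} (S : Matrix (Fin N) (Fin M) ℝ) {q : Fin N → ℝ}
    (h : S.transpose.mulVec q = 0) : (aMat S * Matrix.vecMulVec q q).trace = 0 := by
  rw [aMat, Matrix.smul_mul, Matrix.mul_assoc, Matrix.mul_vecMulVec, h]
  simp

theorem sub_sq_sub_cube_le_log_one_add {u : ℝ} (hu : |u| ≤ 1 / 2) :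
    u - u ^ 2 / 2 - 2 * |u| ^ 3 ≤ Real.log (1 + u) := by
  have h := Real.abs_log_sub_add_sum_range_le (x := -u) (by rw [abs_neg]; linarith) 2
  have h2 : |(-u)| ^ (2 + 1) / (1 - |(-u)|) ≤ 2 * |u| ^ 3 := by
    rw [abs_neg, div_le_iff₀ (by linarith)]
    have : 0 ≤ |u| ^ 3 := by positivity
    norm_num
    nlinarith
  have h3 := neg_le_of_abs_le (h.trans h2)
  simp [Finset.sum_range_succ] at h3
  norm_num at h3
  linarith

/-- An exponential transform of `V` lying above a quadratic polynomial yields an element of the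
second-order subjet of `V`. -/
theorem inSubjet_of_one_add_le_exp {N : ℕ} {V : EuclideanSpace ℝ (Fin N) → ℝ}
    {x q : EuclideanSpace ℝ (Fin N)} {Z : Matrix (Fin N) (Fin N) ℝ} (hZ : Z.IsSymm) {l : ℝ}
    (hl : 0 < l)
    (h : ∀ᶠ y in nhds x, 1 + l * (dotP q (y - x) + 1 / 2 * quadF Z (y - x)) ≤
      Real.exp (l * (V y - V x))) :
    InSubjet V x q (Z - l • Matrix.vecMulVec q.ofLp q.ofLp) := by
  refine ⟨hZ.sub (Matrix.IsSymm.smul (Matrix.transpose_vecMulVec _ _) _), fun ε hε => ?_⟩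
  obtain ⟨δ, hδ, hh⟩ := Metric.eventually_nhds_iff.1 h
  obtain ⟨C, hC, hq⟩ := exists_abs_dotP_le q
  obtain ⟨D, hD, hQ⟩ := exists_abs_quadF_le Z
  set B := C + D + 1 with hB
  have hB1 : 1 ≤ B := by linarith
  set R := l * B ^ 2 + 2 * l ^ 2 * B ^ 3 with hR
  have hRpos : 0 < R := by positivity
  refine ⟨min (min δ 1) (min (1 / (2 * l * B)) (ε / R)), by positivity, fun y hy => ?_⟩
  simp only [lt_min_iff] at hy
  obtain ⟨⟨hyδ, hy1⟩, hyl, hyR⟩ := hy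
  have hy2 := hh (by rwa [dist_eq_norm] : dist y x < δ)
  rw [lt_div_iff₀ (by positivity)] at hyl hyR
  rw [quadF_sub_smul_vecMulVec_s5]
  have hqd := hq (y - x)
  have hQd := hQ (y - x)
  set d := ‖y - x‖ with hd
  have hd0 : 0 ≤ d := norm_nonneg _
  set s := dotP q (y - x)
  set t := quadF Z (y - x)
  have hs : |s| ≤ B * d := hqd.trans (by gcongr; linarith)
  have ht : |t| ≤ B * d ^ 2 := hQd.trans (by gcongr; linarith)
  have hd2 : d ^ 2 ≤ d := by nlinarith
  have hst : |s + 1 / 2 * t| ≤ B * d := by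
    have h1 : |s + 1 / 2 * t| ≤ |s| + 1 / 2 * |t| := by
      refine (abs_add_le _ _).trans ?_
      rw [abs_mul]; norm_num
    nlinarith
  have hu : |l * (s + 1 / 2 * t)| ≤ l * (B * d) := by
    rw [abs_mul, abs_of_pos hl]; gcongr
  have hlog := sub_sq_sub_cube_le_log_one_add (hu.trans (by linarith))
  have hpos : 0 < 1 + l * (s + 1 / 2 * t) := by
    have := neg_le_of_abs_le hu
    linarith
  have hV := (Real.log_le_iff_le_exp hpos).2 hy2
  have hcube : |l * (s + 1 / 2 * t)| ^ 3 ≤ (l * (B * d)) ^ 3 := by gcongr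
  have hsq : (s + 1 / 2 * t) ^ 2 - s ^ 2 ≤ 2 * B ^ 2 * d ^ 3 := by
    have h1 : (s + 1 / 2 * t) ^ 2 - s ^ 2 = (1 / 2 * t) * ((s + 1 / 2 * t) + s) := by ring
    rw [h1]
    refine (le_abs_self _).trans ?_
    rw [abs_mul, abs_mul]
    calc |(1 / 2 : ℝ)| * |t| * |s + 1 / 2 * t + s|
        ≤ 1 * (B * d ^ 2) * (B * d + B * d) := by
          gcongr
          · norm_num [abs_le]
          · exact (abs_add_le _ _).trans (add_le_add hst hs)
      _ = 2 * B ^ 2 * d ^ 3 := by ring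
  have hfin : R * d ^ 3 ≤ ε * d ^ 2 := by nlinarith [mul_nonneg hd0 hd0]
  have key : l * (s + 1 / 2 * (t - l * s ^ 2) - ε * d ^ 2) ≤ l * (V y - V x) := by
    refine le_trans ?_ (hlog.trans hV)
    have e : (l * (s + 1 / 2 * t)) ^ 2 = l ^ 2 * (((s + 1 / 2 * t) ^ 2 - s ^ 2) + s ^ 2) := by ring
    rw [e]
    have h1 := mul_le_mul_of_nonneg_left hsq (sq_nonneg l)
    have h2 := mul_le_mul_of_nonneg_left hfin hl.le
    have h3 : l * (R * d ^ 3) = l ^ 2 / 2 * (2 * B ^ 2 * d ^ 3) + 2 * (l * (B * d)) ^ 3 := by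
      rw [hR]; ring
    linarith
  have := le_of_mul_le_mul_left key hl
  linarith

/-- For large `l` the penalisation `exp (l * v y) / l` beats `g y` uniformly on a compact set. -/
theorem exists_penalization {X : Type*} [TopologicalSpace X] {S : Set X} (hS : IsCompact S)
    {v g : X → ℝ} (hv : LowerSemicontinuous v) (hg : Continuous g) {c : ℝ} (hc : 0 < c)
    (h : ∀ y ∈ S, v y ≤ 0 → g y ≤ -c) :
    ∃ l : ℝ, 0 < l ∧ ∀ y ∈ S, 1 / l < Real.exp (l * v y) / l - g y := by
  obtain ⟨C, hC⟩ := (hS.bddAbove_image hg.continuousOn)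
  have hC' : ∀ y ∈ S, g y ≤ C := fun y hy => hC ⟨y, hy, rfl⟩
  have hT : IsCompact (S ∩ {y | -(c / 2) ≤ g y}) :=
    hS.inter_right (isClosed_le continuous_const hg)
  obtain ⟨δ, hδ, hδT⟩ : ∃ δ > 0, ∀ y ∈ S ∩ {y | -(c / 2) ≤ g y}, δ ≤ v y := by
    rcases (S ∩ {y | -(c / 2) ≤ g y}).eq_empty_or_nonempty with he | hne
    · exact ⟨1, one_pos, by simp [he]⟩
    · obtain ⟨z, hz, hmin⟩ := (hv.lowerSemicontinuousOn _).exists_isMinOn hne hT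
      refine ⟨v z, ?_, fun y hy => hmin hy⟩
      by_contra! hn
      have h1 := h z hz.1 hn
      have h2 : -(c / 2) ≤ g z := hz.2
      linarith
  have hl : Filter.Tendsto (fun l : ℝ => l * (δ ^ 2 / 2)) Filter.atTop Filter.atTop :=
    Filter.tendsto_id.atTop_mul_const (by positivity)
  obtain ⟨l, h1, h2, h3⟩ := ((Filter.eventually_gt_atTop (2 / c)).and
    ((Filter.eventually_gt_atTop (1 : ℝ)).and (hl.eventually_gt_atTop (C + 1)))).exists
  have hl0 : 0 < l := by linarith
  refine ⟨l, hl0, fun y hy => ?_⟩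
  by_cases hyT : -(c / 2) ≤ g y
  · have hd := hδT y ⟨hy, hyT⟩
    have hexp : (l * δ) ^ 2 / 2 ≤ Real.exp (l * v y) := by
      have := Real.quadratic_le_exp_of_nonneg (x := l * δ) (by positivity)
      have h4 : Real.exp (l * δ) ≤ Real.exp (l * v y) := by gcongr
      have : 0 < l * δ := by positivity
      linarith
    have h5 : l * (δ ^ 2 / 2) ≤ Real.exp (l * v y) / l := by
      rw [le_div_iff₀ hl0]; linarith
    have h6 : 1 / l < 1 := by rw [div_lt_one hl0]; exact h2
    linarith [hC' y hy]
  · have h4 : 1 / l < c / 2 := by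
      rw [div_lt_iff₀ hc] at h1
      rw [div_lt_iff₀ hl0]; linarith
    have : 0 < Real.exp (l * v y) / l := by positivity
    linarith

theorem continuous_dotP {X : Type*} [TopologicalSpace X] {N : ℕ}
    {u v : X → EuclideanSpace ℝ (Fin N)} (hu : Continuous u) (hv : Continuous v) :
    Continuous fun z => dotP (u z) (v z) := by
  unfold dotP; fun_prop

theorem continuous_quadF {N : ℕ} (Y : Matrix (Fin N) (Fin N) ℝ) : Continuous (quadF Y) := by
  unfold quadF; fun_prop

/-- Arbitrarily close to a point of a sublevel set of `V`, and up to an arbitrarily small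
perturbation `e`, a second-order normal is proportional to an element of the subjet of `V`, modulo
a rank-one term. -/
theorem exists_inSubjet_of_inNormalCone {N : ℕ} {V : EuclideanSpace ℝ (Fin N) → ℝ}
    (hlsc : LowerSemicontinuous V) {μ : ℝ} {x p : EuclideanSpace ℝ (Fin N)} (hx : V x ≤ μ)
    {Y : Matrix (Fin N) (Fin N) ℝ} (hY : InNormalCone {x | V x ≤ μ} x p Y) {e r : ℝ} (he : 0 < e)
    (hr : 0 < r) :
    ∃ y, ‖y - x‖ < r ∧ ∃ b > (0 : ℝ), ∃ c : ℝ, ∃ q : EuclideanSpace ℝ (Fin N),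
      q = -(b • (p + WithLp.toLp 2 ((Y + (2 * e) • 1).mulVec (y - x).ofLp))) ∧
      InSubjet V y q (-(b • (Y + (2 * e) • 1)) - c • Matrix.vecMulVec q.ofLp q.ofLp) := by
  obtain ⟨hsymm, hcone⟩ := hY
  obtain ⟨δ, hδ, hcone⟩ := hcone (e / 2) (by positivity)
  set W := Y + (2 * e) • (1 : Matrix (Fin N) (Fin N) ℝ) with hW
  have hWs : W.IsSymm := hsymm.add (Matrix.isSymm_one.smul _)
  set g : EuclideanSpace ℝ (Fin N) → ℝ := fun y => -(dotP p (y - x) + 1 / 2 * quadF W (y - x))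
    with hg
  have hgc : Continuous g := by
    have h1 := continuous_dotP (continuous_const (y := p))
      (continuous_id.sub (continuous_const (y := x)))
    have h2 := (continuous_quadF W).comp (continuous_id.sub (continuous_const (y := x)))
    exact (h1.add (continuous_const.mul h2)).neg
  set ρ := min r δ / 2 with hρ
  have hρ0 : 0 < ρ := by positivity
  have hρr : ρ < r := by linarith [min_le_left r δ, lt_min hr hδ]
  have hρδ : ρ < δ := by linarith [min_le_right r δ, lt_min hr hδ]
  have hvl : LowerSemicontinuous fun y => V y - μ := by
    simpa [sub_eq_add_neg] using hlsc.add (continuous_const (y := -μ)).lowerSemicontinuous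
  obtain ⟨l, hl, hS⟩ := exists_penalization (isCompact_sphere x ρ) hvl hgc
    (c := e / 2 * ρ ^ 2) (by positivity) (by
      intro y hy hVy
      have hn : ‖y - x‖ = ρ := by simpa [dist_eq_norm] using hy
      have := hcone y (by simpa using hVy) (by rw [hn]; exact hρδ)
      simp only [hg, hW, quadF_add_smul_one]
      rw [hn] at this ⊢
      linarith)
  set F : EuclideanSpace ℝ (Fin N) → ℝ := fun y => Real.exp (l * (V y - μ)) / l - g y with hF
  have hFl : LowerSemicontinuous F := by
    have h1 : LowerSemicontinuous fun y => Real.exp (l * (V y - μ)) / l := by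
      refine Continuous.comp_lowerSemicontinuous (g := fun t => Real.exp (l * (t - μ)) / l)
        (by fun_prop) hlsc fun a b hab => ?_
      dsimp only
      gcongr
    simpa [hF, sub_eq_add_neg] using h1.add hgc.neg.lowerSemicontinuous
  obtain ⟨y, hy, hmin⟩ := (hFl.lowerSemicontinuousOn _).exists_isMinOn
    ⟨x, Metric.mem_closedBall_self hρ0.le⟩ (isCompact_closedBall x ρ)
  have hFx : F x ≤ 1 / l := by
    have : g x = 0 := by simp [hg, dotP, quadF]
    simp only [hF, this, sub_zero]
    gcongr
    rw [Real.exp_le_one_iff]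
    exact mul_nonpos_of_nonneg_of_nonpos hl.le (by linarith)
  have hyb : y ∈ Metric.ball x ρ := by
    rcases (Metric.mem_closedBall.1 hy).lt_or_eq with h | h
    · exact h
    · exact absurd ((hmin (Metric.mem_closedBall_self hρ0.le)).trans hFx) (not_le.2 (hS y h))
  set b := Real.exp (-(l * (V y - μ))) with hb
  refine ⟨y, ?_, b, Real.exp_pos _, l, _, rfl, ?_⟩
  · rw [← dist_eq_norm]; exact (Metric.mem_ball.1 hyb).trans hρr
  refine inSubjet_of_one_add_le_exp (hWs.smul _).neg hl ?_
  filter_upwards [Metric.isOpen_ball.mem_nhds hyb] with z hz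
  have hFz : F y ≤ F z := hmin (Metric.ball_subset_closedBall hz)
  have hgz : g z - g y = -(dotP (p + WithLp.toLp 2 (W.mulVec (y - x).ofLp)) (z - y)
      + 1 / 2 * quadF W (z - y)) := by
    have h1 : z - x = (y - x) + (z - y) := by abel
    simp only [hg, h1, quadF_add hWs]
    simp only [dotP_eq_dotProduct, WithLp.ofLp_add, dotProduct_add, add_dotProduct]
    ring
  have hlin : dotP (-(b • (p + WithLp.toLp 2 (W.mulVec (y - x).ofLp)))) (z - y)
      + 1 / 2 * quadF (-(b • W)) (z - y) = b * (g z - g y) := by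
    rw [hgz]
    simp only [dotP_eq_dotProduct, quadF_eq_dotProduct, WithLp.ofLp_neg, WithLp.ofLp_smul,
      neg_dotProduct, smul_dotProduct, Matrix.neg_mulVec, Matrix.smul_mulVec, dotProduct_neg,
      dotProduct_smul, smul_eq_mul]
    ring
  rw [hlin]
  have hexp : Real.exp (l * (V z - V y)) = b * Real.exp (l * (V z - μ)) := by
    rw [hb, ← Real.exp_add]; ring_nf
  have hone : b * Real.exp (l * (V y - μ)) = 1 := by
    rw [hb, ← Real.exp_add]; simp
  have hFz' : l * (g z - g y) ≤ Real.exp (l * (V z - μ)) - Real.exp (l * (V y - μ)) := by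
    simp only [hF] at hFz
    have h1 := mul_le_mul_of_nonneg_left hFz hl.le
    have h2 (t : ℝ) : l * (t / l) = t := by field_simp
    rw [mul_sub l (_ / l), mul_sub l (_ / l), h2, h2] at h1
    linarith
  rw [hexp]
  have := mul_le_mul_of_nonneg_left hFz' (Real.exp_pos _ : 0 < b).le
  linarith

/-- sublevel sets of a control Lyapunov function are closed, are neighborhoods
of the origin, and satisfy the Nagumo-type condition of the viability theorem. -/
theorem stmt5 {N M : ℕ} {A : Type*} [MetricSpace A] [CompactSpace A] [Nonempty A]
    (f : EuclideanSpace ℝ (Fin N) → A → EuclideanSpace ℝ (Fin N))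
    (σ : EuclideanSpace ℝ (Fin N) → A → Matrix (Fin N) (Fin M) ℝ)
    (hf : Continuous fun q : EuclideanSpace ℝ (Fin N) × A => f q.1 q.2)
    (hσ : Continuous fun q : EuclideanSpace ℝ (Fin N) × A => σ q.1 q.2)
    (V : EuclideanSpace ℝ (Fin N) → ℝ) (hV0 : ∀ x, 0 ≤ V x)
    (hlsc : LowerSemicontinuous V)
    (hVzero : V 0 = 0) (hVpos : ∀ x : EuclideanSpace ℝ (Fin N), x ≠ 0 → 0 < V x)
    (hVcont : ContinuousAt V 0)
    (hV : ∀ x : EuclideanSpace ℝ (Fin N), x ≠ 0 → ∀ p Y, InSubjet V x p Y →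
      ∃ α : A, (σ x α).transpose.mulVec (fun i => p i) = 0 ∧
        0 ≤ -dotP p (f x α) - (aMat (σ x α) * Y).trace)
    (μ : ℝ) (hμ : 0 < μ) :
    IsClosed {x | V x ≤ μ} ∧ {x | V x ≤ μ} ∈ nhds (0 : EuclideanSpace ℝ (Fin N)) ∧
    ∀ x ∈ frontier {x | V x ≤ μ}, ∀ p Y, InNormalCone {x | V x ≤ μ} x p Y →
      ∃ α : A, 0 ≤ dotP (f x α) p + (aMat (σ x α) * Y).trace := by
  have hclosed : IsClosed {x | V x ≤ μ} := hlsc.isClosed_preimage μ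
  have hnhds : {x | V x ≤ μ} ∈ nhds (0 : EuclideanSpace ℝ (Fin N)) := by
    filter_upwards [hVcont.eventually_lt continuousAt_const (by rwa [hVzero])] with y hy using
      le_of_lt hy
  refine ⟨hclosed, hnhds, fun x hx p Y hY => ?_⟩
  have hx0 : x ≠ 0 := by
    rintro rfl
    exact hx.2 (mem_interior_iff_mem_nhds.2 hnhds)
  have hxK : V x ≤ μ := hclosed.frontier_subset hx
  by_contra! hneg
  set G : (EuclideanSpace ℝ (Fin N) × ℝ) × A → ℝ := fun z =>
    dotP (f z.1.1 z.2)
        (p + WithLp.toLp 2 ((Y + (2 * z.1.2) • 1).mulVec (z.1.1 - x).ofLp))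
      + (aMat (σ z.1.1 z.2) * (Y + (2 * z.1.2) • 1)).trace with hG
  have hGc : Continuous G := by
    have hf' : Continuous fun z : (EuclideanSpace ℝ (Fin N) × ℝ) × A => f z.1.1 z.2 :=
      hf.comp (by fun_prop : Continuous
        fun z : (EuclideanSpace ℝ (Fin N) × ℝ) × A => (z.1.1, z.2))
    have hσ' : Continuous fun z : (EuclideanSpace ℝ (Fin N) × ℝ) × A => σ z.1.1 z.2 :=
      hσ.comp (by fun_prop : Continuous
        fun z : (EuclideanSpace ℝ (Fin N) × ℝ) × A => (z.1.1, z.2))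
    have hW : Continuous fun z : (EuclideanSpace ℝ (Fin N) × ℝ) × A =>
        Y + (2 * z.1.2) • (1 : Matrix (Fin N) (Fin N) ℝ) := by fun_prop
    refine (continuous_dotP hf' (continuous_const.add
      ((PiLp.continuous_toLp 2 _).comp (hW.matrix_mulVec (by fun_prop))))).add ?_
    exact (((hσ'.matrix_mul hσ'.matrix_transpose).const_smul (1 / 2 : ℝ)).matrix_mul
      hW).matrix_trace
  have hev : ∀ᶠ w in nhds (x, (0 : ℝ)), ∀ α ∈ (Set.univ : Set A), G (w, α) < 0 := by
    refine isCompact_univ.eventually_forall_of_forall_eventually fun α _ => ?_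
    refine hGc.continuousAt.eventually_lt continuousAt_const ?_
    simpa [hG, dotP] using hneg α
  obtain ⟨r, hr, hball⟩ := Metric.eventually_nhds_iff.1 hev
  obtain ⟨y, hy, b, hb, c, q, hq, hsub⟩ := exists_inSubjet_of_inNormalCone hlsc hxK hY
    (half_pos hr) (lt_min hr (norm_pos_iff.2 hx0))
  rw [lt_min_iff] at hy
  have hy0 : y ≠ 0 := by
    rintro rfl
    simpa using hy.2
  obtain ⟨α, hα, hle⟩ := hV y hy0 q _ hsub
  have hlt := hball (y := (y, r / 2)) (by
    rw [Prod.dist_eq, max_lt_iff, dist_eq_norm, Real.dist_eq]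
    refine ⟨hy.1, ?_⟩
    rw [sub_zero, abs_of_pos (by positivity)]
    linarith) α (Set.mem_univ α)
  have hfq : dotP q (f y α) = -(b * dotP (f y α)
      (p + WithLp.toLp 2 ((Y + (2 * (r / 2)) • 1).mulVec (y - x).ofLp))) := by
    rw [hq]
    simp only [dotP_eq_dotProduct, WithLp.ofLp_neg, WithLp.ofLp_smul, neg_dotProduct,
      smul_dotProduct, smul_eq_mul]
    rw [dotProduct_comm]
  have htr : (aMat (σ y α) * (-(b • (Y + (2 * (r / 2)) • 1))
      - c • Matrix.vecMulVec q.ofLp q.ofLp)).trace =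
      -(b * (aMat (σ y α) * (Y + (2 * (r / 2)) • 1)).trace) := by
    rw [Matrix.mul_sub, Matrix.mul_neg, Matrix.mul_smul, Matrix.mul_smul, Matrix.trace_sub,
      Matrix.trace_neg, Matrix.trace_smul, Matrix.trace_smul, trace_aMat_mul_vecMulVec _ hα]
    simp
  rw [hfq, htr] at hle
  simp only [hG] at hlt
  nlinarith [mul_neg_of_pos_of_neg hb hlt]
end
end

section
/- Let O ⊆ ℝ^N be open with 0 ∈ O, let l : O → [0,∞) be continuous, and let V : O → [0,∞) be lower semicontinuous such that for every x ∈ O∖{0} and every (p,Y) ∈ J^{2,−}V(x) there exists ᾱ ∈ A with σ(x,ᾱ)^T p = 0 and −p·f(x,ᾱ) − trace(a(x,ᾱ)Y) − l(x) ≥ 0. Define W : O × ℝ → [0,∞) by W(x,z) := V(x) + |z|. Then for every (x,z) with x ∈ O∖{0} and every (q,Z) ∈ J^{2,−}W(x,z) (second-order subjet in ℝ^{N+1}), writing q = (q_x, q_z) with q_x ∈ ℝ^N, q_z ∈ ℝ, and Z_{xx} for the upper-left N×N block of Z, there exists ᾱ ∈ A such that σ(x,ᾱ)^T q_x = 0 and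 −q_x·f(x,ᾱ) − q_z·l(x) − trace(a(x,ᾱ) Z_{xx}) ≥ 0. -/
open scoped BigOperators

noncomputable section

/-- Second-order subjet relative to a set `Ω ⊆ ℝ^N`. -/
def InSubjetOn {N : ℕ} (Ω : Set (EuclideanSpace ℝ (Fin N))) (V : EuclideanSpace ℝ (Fin N) → ℝ)
    (x p : EuclideanSpace ℝ (Fin N)) (Y : Matrix (Fin N) (Fin N) ℝ) : Prop :=
  Y.IsSymm ∧ ∀ ε > 0, ∃ δ > 0, ∀ y ∈ Ω, ‖y - x‖ < δ →
    V y ≥ V x + dotP p (y - x) + (1/2) * quadF Y (y - x) - ε * ‖y - x‖ ^ 2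

/-- Second-order subjet in `ℝ^{N+1} = ℝ^N × ℝ` (first variable restricted to `O`) of a
function `W(x,z)`, written in block form: the first-order part is `q = (qx, qz)` and the
second-order part is the symmetric matrix `Z` with blocks `Zxx` (upper-left `N × N`),
`Zxz` (off-diagonal column) and `Zzz` (lower-right entry). -/
def InSubjetProd {N : ℕ} (O : Set (EuclideanSpace ℝ (Fin N)))
    (W : EuclideanSpace ℝ (Fin N) → ℝ → ℝ)
    (x : EuclideanSpace ℝ (Fin N)) (z : ℝ)
    (qx : EuclideanSpace ℝ (Fin N)) (qz : ℝ)
    (Zxx : Matrix (Fin N) (Fin N) ℝ) (Zxz : EuclideanSpace ℝ (Fin N)) (Zzz : ℝ) : Prop :=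
  Zxx.IsSymm ∧ ∀ ε > 0, ∃ δ > 0, ∀ y ∈ O, ∀ w : ℝ, ‖y - x‖ < δ → |w - z| < δ →
    W y w ≥ W x z + dotP qx (y - x) + qz * (w - z) +
      (1/2) * (quadF Zxx (y - x) + 2 * dotP Zxz (y - x) * (w - z) + Zzz * (w - z) ^ 2) -
      ε * (‖y - x‖ ^ 2 + (w - z) ^ 2)

/-- A subjet of `V x + g z` restricts to a subjet of `V` in the first variable. -/
lemma InSubjetProd.inSubjetOn {N : ℕ} {O : Set (EuclideanSpace ℝ (Fin N))}
    {V : EuclideanSpace ℝ (Fin N) → ℝ} {g : ℝ → ℝ} {x : EuclideanSpace ℝ (Fin N)} {z : ℝ}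
    {qx : EuclideanSpace ℝ (Fin N)} {qz : ℝ} {Zxx : Matrix (Fin N) (Fin N) ℝ}
    {Zxz : EuclideanSpace ℝ (Fin N)} {Zzz : ℝ}
    (h : InSubjetProd O (fun y w => V y + g w) x z qx qz Zxx Zxz Zzz) :
    InSubjetOn O V x qx Zxx := by
  refine ⟨h.1, fun ε hε => ?_⟩
  obtain ⟨δ, hδ, H⟩ := h.2 ε hε
  refine ⟨δ, hδ, fun y hy hyx => ?_⟩
  have key := H y hy z hyx (by simpa using hδ)
  simp only [sub_self] at key
  linarith

/-- The last component of the first-order part of a subjet of `V x + |z|` is at most `1`. -/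
lemma InSubjetProd.le_one {N : ℕ} {O : Set (EuclideanSpace ℝ (Fin N))}
    {V : EuclideanSpace ℝ (Fin N) → ℝ} {x : EuclideanSpace ℝ (Fin N)} {z : ℝ}
    {qx : EuclideanSpace ℝ (Fin N)} {qz : ℝ} {Zxx : Matrix (Fin N) (Fin N) ℝ}
    {Zxz : EuclideanSpace ℝ (Fin N)} {Zzz : ℝ} (hx : x ∈ O)
    (h : InSubjetProd O (fun y w => V y + |w|) x z qx qz Zxx Zxz Zzz) : qz ≤ 1 := by
  by_contra! hq
  obtain ⟨δ, hδ, H⟩ := h.2 1 one_pos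
  have hc : 0 < 2 * (1 + |Zzz|) := by positivity
  obtain ⟨t, ht, htm⟩ := exists_between (lt_min hδ (div_pos (sub_pos.2 hq) hc))
  have ht1 := htm.trans_le (min_le_left _ _)
  have ht2 := (lt_div_iff₀ hc).1 (htm.trans_le (min_le_right _ _))
  have key := H x hx (z + t) (by simpa using hδ) (by simpa [abs_of_pos ht] using ht1)
  simp only [sub_self, add_sub_cancel_left, dotP, quadF, PiLp.zero_apply, mul_zero, zero_mul,
    Finset.sum_const_zero, norm_zero] at key
  have h1 := abs_add_le z t
  rw [abs_of_pos ht] at h1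
  have h2 : t * (qz - 1) ≤ t * (t * (1 + |Zzz|)) := by
    nlinarith [mul_le_mul_of_nonneg_left (neg_abs_le Zzz) (sq_nonneg t),
      mul_nonneg (sq_nonneg t) (abs_nonneg Zzz)]
  have h3 := le_of_mul_le_mul_left h2 ht
  nlinarith

/-- if `V` is a strict control Lyapunov function (with rate `l`) on `O`, then
`W(x,z) = V(x) + |z|` satisfies the corresponding constrained condition for the augmented
system `(f, l)` with diffusion `(σ, 0)`, for every subjet element at points `(x,z)`, `x ≠ 0`. -/
theorem stmt6 {N M : ℕ} {A : Type*} [MetricSpace A] [CompactSpace A] [Nonempty A]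
    (f : EuclideanSpace ℝ (Fin N) → A → EuclideanSpace ℝ (Fin N))
    (σ : EuclideanSpace ℝ (Fin N) → A → Matrix (Fin N) (Fin M) ℝ)
    (hf : Continuous fun q : EuclideanSpace ℝ (Fin N) × A => f q.1 q.2)
    (hσ : Continuous fun q : EuclideanSpace ℝ (Fin N) × A => σ q.1 q.2)
    (O : Set (EuclideanSpace ℝ (Fin N))) (hO : IsOpen O) (hO0 : (0 : EuclideanSpace ℝ (Fin N)) ∈ O)
    (l : EuclideanSpace ℝ (Fin N) → ℝ) (hl : ContinuousOn l O) (hl0 : ∀ x ∈ O, 0 ≤ l x)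
    (V : EuclideanSpace ℝ (Fin N) → ℝ) (hV0 : ∀ x ∈ O, 0 ≤ V x)
    (hlsc : LowerSemicontinuousOn V O)
    (hV : ∀ x ∈ O, x ≠ 0 → ∀ p Y, InSubjetOn O V x p Y →
      ∃ α : A, (σ x α).transpose.mulVec (fun i => p i) = 0 ∧
        0 ≤ -dotP p (f x α) - (aMat (σ x α) * Y).trace - l x) :
    ∀ x ∈ O, x ≠ 0 → ∀ (z : ℝ) (qx : EuclideanSpace ℝ (Fin N)) (qz : ℝ)
      (Zxx : Matrix (Fin N) (Fin N) ℝ) (Zxz : EuclideanSpace ℝ (Fin N)) (Zzz : ℝ),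
      InSubjetProd O (fun y w => V y + |w|) x z qx qz Zxx Zxz Zzz →
      ∃ α : A, (σ x α).transpose.mulVec (fun i => qx i) = 0 ∧
        0 ≤ -dotP qx (f x α) - qz * l x - (aMat (σ x α) * Zxx).trace := by
  intro x hx hx0 z qx qz Zxx Zxz Zzz h
  obtain ⟨α, hα, hle⟩ := hV x hx hx0 qx Zxx h.inSubjetOn
  refine ⟨α, hα, ?_⟩
  have := mul_le_mul_of_nonneg_right (h.le_one hx) (hl0 x hx)
  linarith
end
end

section
/- Let Ω ⊆ ℝ^N be open, V : Ω → ℝ lower semicontinuous, and define W : Ω × ℝ → ℝ by W(y,w) := V(y) + |w|. Let x ∈ Ω and let φ be a real-valued function twice continuously differentiable on a neighborhood of (x,0) in Ω × ℝ such that W − φ has a local minimum at (x,0). Then (D_xφ(x,0), D²_{xx}φ(x,0)) ∈ J^{2,−}V(x) and |∂_zφ(x,0)| ≤ 1, where D_xφ and D²_{xx}φ denote the gradient and Hessian in the first N variables and ∂_zφ the partial derivative in the last variable. -/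
open scoped BigOperators

noncomputable section

/-- Second-order Taylor expansion with Peano remainder. -/
theorem ContDiffAt.eventually_taylor_two_remainder_le {E F : Type*} [NormedAddCommGroup E]
    [NormedSpace ℝ E] [NormedAddCommGroup F] [NormedSpace ℝ F] {f : E → F} {x : E}
    (hf : ContDiffAt ℝ 2 f x) {ε : ℝ} (hε : 0 < ε) :
    ∃ δ > 0, ∀ y, ‖y - x‖ < δ →
      ‖f y - f x - fderiv ℝ f x (y - x) -
        (1 / 2 : ℝ) • fderiv ℝ (fderiv ℝ f) x (y - x) (y - x)‖ ≤ ε * ‖y - x‖ ^ 2 := by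
  have hsymm : IsSymmSndFDerivAt ℝ f x := hf.isSymmSndFDerivAt (by simp)
  have hdiff : ∀ᶠ y in nhds x, DifferentiableAt ℝ f y :=
    (hf.eventually (by simp)).mono fun y hy => hy.differentiableAt (by simp)
  have hderiv : HasFDerivAt (fderiv ℝ f) (fderiv ℝ (fderiv ℝ f) x) x :=
    ((hf.fderiv_right (m := 1) (by norm_num)).differentiableAt (by simp)).hasFDerivAt
  set B := fderiv ℝ (fderiv ℝ f) x with hB
  obtain ⟨δ, hδ, hball⟩ := Metric.eventually_nhds_iff.1 (hdiff.and (hderiv.isLittleO.def hε))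
  refine ⟨δ, hδ, fun y hy => ?_⟩
  have hR : ∀ z ∈ Metric.closedBall x ‖y - x‖, HasFDerivWithinAt
      (fun z => f z - f x - fderiv ℝ f x (z - x) - (1 / 2 : ℝ) • B (z - x) (z - x))
      (fderiv ℝ f z - fderiv ℝ f x - B (z - x)) (Metric.closedBall x ‖y - x‖) z := by
    intro z hz
    have hsub : HasFDerivAt (fun z : E => z - x) (ContinuousLinearMap.id ℝ E) z :=
      (hasFDerivAt_id z).sub_const x
    have hz' := (hball (lt_of_le_of_lt hz hy)).1.hasFDerivAt
    have hquad := ((B.hasFDerivAt.comp z hsub).clm_apply hsub).const_smul (1 / 2 : ℝ)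
    have hsum := ((hz'.sub_const (f x)).sub ((fderiv ℝ f x).hasFDerivAt.comp z hsub)).sub hquad
    refine (hsum.congr_fderiv ?_).hasFDerivWithinAt
    ext v
    have hv : B v z - B v x = B z v - B x v := by simpa using hsymm.eq v (z - x)
    simp only [one_div, ContinuousLinearMap.comp_id, Function.comp_apply, map_sub, smul_add,
      sub_apply, add_apply, smul_apply, ContinuousLinearMap.flip_apply, hv]
    rw [← add_smul]
    norm_num
  have hbound : ∀ z ∈ Metric.closedBall x ‖y - x‖,
      ‖fderiv ℝ f z - fderiv ℝ f x - B (z - x)‖ ≤ ε * ‖y - x‖ := by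
    intro z hz
    refine (hball (lt_of_le_of_lt hz hy)).2.trans ?_
    gcongr
    simpa [dist_eq_norm] using hz
  have := (convex_closedBall x ‖y - x‖).norm_image_sub_le_of_norm_hasFDerivWithin_le hR hbound
    (Metric.mem_closedBall_self (norm_nonneg _)) (by simp [dist_eq_norm] : y ∈ _)
  simpa [pow_two, mul_assoc] using this

theorem EuclideanSpace.sum_smul_single {N : ℕ} (v : EuclideanSpace ℝ (Fin N)) :
    ∑ i, v i • EuclideanSpace.single i (1 : ℝ) = v := by
  simpa using (EuclideanSpace.basisFun (Fin N) ℝ).sum_repr v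

theorem dotP_eq_of_apply_single {N : ℕ} {p : EuclideanSpace ℝ (Fin N)}
    {L : EuclideanSpace ℝ (Fin N) →L[ℝ] ℝ} (hp : ∀ i, p i = L (EuclideanSpace.single i 1))
    (v : EuclideanSpace ℝ (Fin N)) : dotP p v = L v := by
  conv_rhs => rw [← EuclideanSpace.sum_smul_single v]
  simp [dotP, hp, mul_comm]

theorem quadF_eq_of_apply_single {N : ℕ} {H : Matrix (Fin N) (Fin N) ℝ}
    {B : EuclideanSpace ℝ (Fin N) →L[ℝ] EuclideanSpace ℝ (Fin N) →L[ℝ] ℝ}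
    (hH : ∀ i j, H i j = B (EuclideanSpace.single i 1) (EuclideanSpace.single j 1))
    (v : EuclideanSpace ℝ (Fin N)) : quadF H v = B v v := by
  conv_rhs => rw [← EuclideanSpace.sum_smul_single v]
  simp only [quadF, hH, map_sum, map_smul, sum_apply,
    smul_apply, smul_eq_mul, Finset.mul_sum]
  rw [Finset.sum_comm]
  exact Finset.sum_congr rfl fun i _ => Finset.sum_congr rfl fun j _ => by ring

theorem HasDerivAt.abs_le_of_eventually_sub_le {g : ℝ → ℝ} {g' a C : ℝ} (hg : HasDerivAt g g' a)
    (h : ∀ᶠ w in nhds a, g w - g a ≤ C * |w - a|) : |g'| ≤ C := by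
  refine le_of_forall_pos_le_add fun ε hε => ?_
  obtain ⟨δ, hδ, hball⟩ := Metric.eventually_nhds_iff.1 (h.and (hg.isLittleO.def hε))
  have key : ∀ t, |t| = δ / 2 → t * g' ≤ (C + ε) * (δ / 2) := by
    intro t ht
    have := hball (y := a + t) (by simp [ht, hδ])
    simp only [add_sub_cancel_left, ht, Real.norm_eq_abs, smul_eq_mul] at this
    linarith [neg_abs_le (g (a + t) - g a - t * g'), this.1, this.2]
  have h1 := key (δ / 2) (abs_of_pos (by positivity))
  have h2 := key (-(δ / 2)) (by rw [abs_neg, abs_of_pos (by positivity)])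
  rw [abs_le]
  constructor <;> nlinarith

/-- if `W(y,w) = V(y) + |w|` and `W - φ` has a local minimum at `(x,0)` over
`Ω × ℝ`, with `φ` twice continuously differentiable near `(x,0)`, then
`(D_xφ(x,0), D²_{xx}φ(x,0)) ∈ J^{2,-}V(x)` and `|∂_zφ(x,0)| ≤ 1`. -/
theorem stmt7 {N : ℕ} (Ω : Set (EuclideanSpace ℝ (Fin N))) (hΩ : IsOpen Ω)
    (V : EuclideanSpace ℝ (Fin N) → ℝ) (hlsc : LowerSemicontinuousOn V Ω)
    (x : EuclideanSpace ℝ (Fin N)) (hx : x ∈ Ω)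
    (φ : EuclideanSpace ℝ (Fin N) × ℝ → ℝ)
    (hφ : ContDiffAt ℝ 2 φ (x, 0))
    (hmin : IsLocalMinOn (fun q : EuclideanSpace ℝ (Fin N) × ℝ => V q.1 + |q.2| - φ q)
      (Ω ×ˢ (Set.univ : Set ℝ)) (x, 0))
    (p : EuclideanSpace ℝ (Fin N))
    (hp : ∀ i, p i = fderiv ℝ (fun y => φ (y, 0)) x (EuclideanSpace.single i 1))
    (H : Matrix (Fin N) (Fin N) ℝ)
    (hH : ∀ i j, H i j = iteratedFDeriv ℝ 2 (fun y => φ (y, 0)) x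
      ![EuclideanSpace.single i 1, EuclideanSpace.single j 1]) :
    InSubjetOn Ω V x p H ∧ |deriv (fun w => φ (x, w)) 0| ≤ 1 := by
  have hψ : ContDiffAt ℝ 2 (fun y => φ (y, 0)) x :=
    hφ.comp x (contDiffAt_id.prodMk contDiffAt_const)
  have hH' : ∀ i j, H i j = fderiv ℝ (fderiv ℝ fun y => φ (y, 0)) x
      (EuclideanSpace.single i 1) (EuclideanSpace.single j 1) := fun i j => by
    rw [hH, iteratedFDeriv_two_apply]
    simp
  obtain ⟨r, hr, hball⟩ := Metric.eventually_nhds_iff.1 (eventually_nhdsWithin_iff.1 hmin)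
  refine ⟨⟨?_, fun ε hε => ?_⟩, ?_⟩
  · ext i j
    rw [Matrix.transpose_apply, hH', hH']
    exact hψ.isSymmSndFDerivAt (by simp) _ _
  · obtain ⟨δ, hδ, hT⟩ := hψ.eventually_taylor_two_remainder_le hε
    refine ⟨min δ r, lt_min hδ hr, fun y hy hyx => ?_⟩
    have h1 := hT y (hyx.trans_le (min_le_left _ _))
    have h2 := hball (y := (y, 0))
      (by simpa [Prod.dist_eq, dist_eq_norm, hr] using hyx.trans_le (min_le_right _ _)) ⟨hy, trivial⟩
    rw [dotP_eq_of_apply_single hp, quadF_eq_of_apply_single hH']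
    simp only [Real.norm_eq_abs, smul_eq_mul] at h1
    simp only [abs_zero, add_zero] at h2
    linarith [(abs_le.1 h1).1]
  · have hg : DifferentiableAt ℝ (fun w => φ (x, w)) 0 :=
      (hφ.comp (0 : ℝ) (contDiffAt_const.prodMk contDiffAt_id)).differentiableAt (by simp)
    refine hg.hasDerivAt.abs_le_of_eventually_sub_le ?_
    refine Metric.eventually_nhds_iff.2 ⟨r, hr, fun w hw => ?_⟩
    have h2 := hball (y := (x, w)) (by simpa [Prod.dist_eq, hr] using hw) ⟨hx, trivial⟩
    simp only [abs_zero, add_zero] at h2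
    rw [sub_zero, one_mul]
    linarith
end
end

section
/- The function φ : S → ℝ is real-analytic on the open set S, and for every (a,b) ∈ S one has φ(a,b) = b/(√(a²+b²) − a). -/
noncomputable section

/-- The set `S = {(a,b) : b > 0 or a < 0}`. -/
def Sset : Set (ℝ × ℝ) := {q | 0 < q.2 ∨ q.1 < 0}

/-- Sontag's function `φ(a,b) = (a + √(a²+b²))/b` for `b ≠ 0`, `φ(a,0) = 0`. -/
def phiS (q : ℝ × ℝ) : ℝ :=
  if q.2 = 0 then 0 else (q.1 + Real.sqrt (q.1 ^ 2 + q.2 ^ 2)) / q.2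

theorem isOpen_Sset : IsOpen Sset :=
  (isOpen_lt continuous_const continuous_snd).union (isOpen_lt continuous_fst continuous_const)

theorem sq_add_sq_pos_of_mem_Sset {q : ℝ × ℝ} (hq : q ∈ Sset) : 0 < q.1 ^ 2 + q.2 ^ 2 := by
  rcases hq with h | h
  · have := pow_pos h 2
    positivity
  · have := sq_pos_of_neg h
    positivity

theorem sqrt_sub_pos_of_mem_Sset {q : ℝ × ℝ} (hq : q ∈ Sset) :
    0 < Real.sqrt (q.1 ^ 2 + q.2 ^ 2) - q.1 := by
  rcases hq with h | h
  · exact sub_pos.2 (Real.lt_sqrt_of_sq_lt (by have := pow_pos h 2; linarith))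
  · linarith [Real.sqrt_nonneg (q.1 ^ 2 + q.2 ^ 2)]

theorem phiS_eq_div {q : ℝ × ℝ} (hq : q ∈ Sset) :
    phiS q = q.2 / (Real.sqrt (q.1 ^ 2 + q.2 ^ 2) - q.1) := by
  unfold phiS
  split_ifs with h
  · simp [h]
  · rw [div_eq_div_iff h (sqrt_sub_pos_of_mem_Sset hq).ne']
    linear_combination Real.sq_sqrt (sq_add_sq_pos_of_mem_Sset hq).le

theorem analyticOnNhd_div_sqrt_sub :
    AnalyticOnNhd ℝ (fun q : ℝ × ℝ => q.2 / (Real.sqrt (q.1 ^ 2 + q.2 ^ 2) - q.1)) Sset := by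
  intro q hq
  refine ContDiffAt.analyticAt (contDiffAt_snd.div ?_ (sqrt_sub_pos_of_mem_Sset hq).ne')
  exact (((contDiffAt_fst.pow 2).add (contDiffAt_snd.pow 2)).sqrt
    (sq_add_sq_pos_of_mem_Sset hq).ne').sub contDiffAt_fst

/-- `φ` is real-analytic on the open set `S`, and on `S` it equals
`b/(√(a²+b²) - a)`. -/
theorem stmt8 :
    AnalyticOnNhd ℝ phiS Sset ∧
    ∀ q ∈ Sset, phiS q = q.2 / (Real.sqrt (q.1 ^ 2 + q.2 ^ 2) - q.1) :=
  ⟨analyticOnNhd_div_sqrt_sub.congr isOpen_Sset fun _ hq => (phiS_eq_div hq).symm,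
    fun _ hq => phiS_eq_div hq⟩
end
end

section
/- Let f, g, σ : ℝ^N → ℝ^N be continuous vector fields, V twice continuously differentiable on ℝ^N∖{0}, and l : ℝ^N∖{0} → (0,∞) continuous. Define γ(x) := f(x)·DV(x) + (1/2)·trace(σ(x)σ(x)^T D²V(x)) + l(x)/2. Assume that for every x ≠ 0 one has σ(x)·DV(x) = 0, and that g(x)·DV(x) = 0 implies γ(x) ≤ −l(x)/2. Define k : ℝ^N∖{0} → ℝ by k(x) := −(γ(x) + √(γ(x)² + (g(x)·DV(x))⁴))/(g(x)·DV(x)) if g(x)·DV(x) ≠ 0, and k(x) := 0 if g(x)·DV(x) = 0. Then k is continuous on ℝ^N∖{0}, and for every x ≠ 0: (f(x) + k(x)g(x))·DV(x) + (1/2)·trace(σ(x)σ(x)^T D²V(x)) ≤ −l(x)/2. -/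
noncomputable section

/-- Rationalised form of the numerator in Sontag's formula. -/
theorem sontag_rationalize {a b : ℝ} (hb : b ≠ 0) :
    (a + √(a ^ 2 + b ^ 4)) / b = b ^ 3 / (√(a ^ 2 + b ^ 4) - a) := by
  have hsq : √(a ^ 2 + b ^ 4) ^ 2 = a ^ 2 + b ^ 4 := Real.sq_sqrt (by positivity)
  have hne : √(a ^ 2 + b ^ 4) - a ≠ 0 := by
    intro h
    rw [sub_eq_zero.mp h] at hsq
    exact pow_ne_zero 4 hb (by linarith)
  rw [div_eq_div_iff hb hne]
  linear_combination hsq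

/-- The rationalised denominator in Sontag's formula is positive on the domain of the formula. -/
theorem sontag_denominator_pos {a b : ℝ} (h : b = 0 → a < 0) :
    0 < √(a ^ 2 + b ^ 4) - a := by
  rw [sub_pos]
  by_cases hb : b = 0
  · exact (h hb).trans_le (Real.sqrt_nonneg _)
  · exact Real.lt_sqrt_of_sq_lt (lt_add_of_pos_right _ (by positivity))

/-- Sontag's universal formula for a single-input affine system with
uncontrolled diffusion: the feedback `k` is continuous off the origin and makes `V` a strict
Lyapunov function (with rate `l/2`) for the closed-loop system. Here `DV(x)·w` is the
differential `fderiv ℝ V x w` and `trace(σσᵀD²V) = σ·(D²V σ)` is the Hessian quadratic form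
`iteratedFDeriv ℝ 2 V x ![σ x, σ x]`. -/
theorem stmt10 {N : ℕ}
    (f g σ : EuclideanSpace ℝ (Fin N) → EuclideanSpace ℝ (Fin N))
    (V : EuclideanSpace ℝ (Fin N) → ℝ) (l γ k : EuclideanSpace ℝ (Fin N) → ℝ)
    (hf : Continuous f) (hg : Continuous g) (hσ : Continuous σ)
    (hV : ContDiffOn ℝ 2 V {x | x ≠ 0})
    (hl : ContinuousOn l {x | x ≠ 0})
    (hlpos : ∀ x : EuclideanSpace ℝ (Fin N), x ≠ 0 → 0 < l x)
    (hγ : ∀ x, γ x = fderiv ℝ V x (f x)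
      + (1/2) * iteratedFDeriv ℝ 2 V x ![σ x, σ x] + l x / 2)
    (horth : ∀ x : EuclideanSpace ℝ (Fin N), x ≠ 0 → fderiv ℝ V x (σ x) = 0)
    (hγneg : ∀ x : EuclideanSpace ℝ (Fin N), x ≠ 0 →
      fderiv ℝ V x (g x) = 0 → γ x ≤ -(l x / 2))
    (hk0 : ∀ x : EuclideanSpace ℝ (Fin N), fderiv ℝ V x (g x) = 0 → k x = 0)
    (hk1 : ∀ x : EuclideanSpace ℝ (Fin N), fderiv ℝ V x (g x) ≠ 0 →
      k x = -((γ x + Real.sqrt (γ x ^ 2 + (fderiv ℝ V x (g x)) ^ 4)) / fderiv ℝ V x (g x))) :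
    ContinuousOn k {x | x ≠ 0} ∧
    ∀ x : EuclideanSpace ℝ (Fin N), x ≠ 0 →
      fderiv ℝ V x (f x + k x • g x)
        + (1/2) * iteratedFDeriv ℝ 2 V x ![σ x, σ x] ≤ -(l x / 2) := by
  have hopen : IsOpen {x : EuclideanSpace ℝ (Fin N) | x ≠ 0} := isOpen_ne
  have hD : ContinuousOn (fderiv ℝ V) {x | x ≠ 0} :=
    hV.continuousOn_fderiv_of_isOpen hopen (by norm_num)
  have hH : ContinuousOn (iteratedFDeriv ℝ 2 V) {x | x ≠ 0} :=
    (hV.continuousOn_iteratedFDerivWithin le_rfl hopen.uniqueDiffOn).congr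
      fun x hx => (iteratedFDerivWithin_of_isOpen 2 hopen hx).symm
  have hb : ContinuousOn (fun x => fderiv ℝ V x (g x)) {x | x ≠ 0} :=
    hD.clm_apply hg.continuousOn
  have hσσ : Continuous fun x => ![σ x, σ x] := by
    refine continuous_pi fun i => ?_
    fin_cases i <;> simpa using hσ
  have hHσ : ContinuousOn (fun x => iteratedFDeriv ℝ 2 V x ![σ x, σ x]) {x | x ≠ 0} :=
    continuous_eval.comp_continuousOn (hH.prodMk hσσ.continuousOn)
  have hγc : ContinuousOn γ {x | x ≠ 0} :=
    (((hD.clm_apply hf.continuousOn).add (continuousOn_const.mul hHσ)).add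
      (hl.div_const 2)).congr fun x _ => hγ x
  refine ⟨?_, fun x hx => ?_⟩
  · have hpos : ∀ x : EuclideanSpace ℝ (Fin N), x ≠ 0 →
        0 < √(γ x ^ 2 + fderiv ℝ V x (g x) ^ 4) - γ x := fun x hx =>
      sontag_denominator_pos fun h => by linarith [hγneg x hx h, hlpos x hx]
    have hden := (((hγc.pow 2).add (hb.pow 4)).sqrt).sub hγc
    refine (((hb.pow 3).div hden fun x hx => (hpos x hx).ne').neg).congr fun x _ => ?_
    by_cases h : fderiv ℝ V x (g x) = 0
    · simp [hk0 x h, h]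
    · simpa using (hk1 x h).trans (congrArg Neg.neg (sontag_rationalize h))
  · have hγx := hγ x
    rw [map_add, map_smul, smul_eq_mul]
    by_cases h : fderiv ℝ V x (g x) = 0
    · rw [h, mul_zero]
      linarith [hγneg x hx h, hlpos x hx]
    · rw [hk1 x h, neg_mul, div_mul_cancel₀ _ h]
      linarith [Real.sqrt_nonneg (γ x ^ 2 + fderiv ℝ V x (g x) ^ 4)]
end
end

section
/- Let f, g_1, …, g_{P−1}, σ, τ : ℝ^N → ℝ^N be continuous vector fields, V twice continuously differentiable on ℝ^N∖{0}, l : ℝ^N∖{0} → (0,∞) continuous, and h : ℝ^N∖{0} → ℝ continuous with (σ(x) + h(x)τ(x))·DV(x) = 0 for all x ≠ 0. Define γ(x) := f(x)·DV(x) + (1/2)·trace[(σ(x)+h(x)τ(x))(σ(x)+h(x)τ(x))^T D²V(x)] + l(x)/2 and β(x) := Σ_{i=1}^{P−1} (g_i(x)·DV(x))². Assume that for every x ≠ 0, β(x) = 0 implies γ(x) ≤ −l(x)/2. Then (γ(x),β(x)) ∈ S for every x ≠ 0, the functions k_i(x) := −φ(γ(x),β(x))·(g_i(x)·DV(x)) (i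 = 1,…,P−1) are continuous on ℝ^N∖{0}, and for every x ≠ 0: (f(x) + Σ_{i=1}^{P−1} k_i(x)g_i(x))·DV(x) + (1/2)·trace[(σ(x)+h(x)τ(x))(σ(x)+h(x)τ(x))^T D²V(x)] + l(x)/2 = −√(γ(x)² + β(x)²) < 0; in particular the left-hand side without the term l(x)/2 is ≤ −l(x)/2. -/
noncomputable section

theorem continuousOn_phiS : ContinuousOn phiS Sset :=
  ContinuousOn.congr (continuous_snd.continuousOn.div (by fun_prop)
    fun _ hq => (sqrt_sub_pos_of_mem_Sset hq).ne') fun _ hq => phiS_eq_div hq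

theorem sub_phiS_mul {q : ℝ × ℝ} (hq : q ∈ Sset) :
    q.1 - phiS q * q.2 = -Real.sqrt (q.1 ^ 2 + q.2 ^ 2) := by
  unfold phiS
  split_ifs with hb
  · have ha : q.1 < 0 := hq.resolve_left (by simp [hb])
    simp [hb, Real.sqrt_sq_eq_abs, abs_of_neg ha]
  · rw [div_mul_cancel₀ _ hb]
    ring

/-- the universal-formula feedback `(k₁,…,k_{P-1})` for a multi-input affine
system with controlled diffusion `σ + hτ`: `(γ,β)` takes values in `S`, each `kᵢ` is
continuous off the origin, and the closed-loop Lyapunov identity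
`(f + Σ kᵢ gᵢ)·DV + (1/2) trace[(σ+hτ)(σ+hτ)ᵀ D²V] + l/2 = -√(γ²+β²) < 0` holds; in
particular the left-hand side without the term `l/2` is `≤ -l/2`.
Here `trace[(σ+hτ)(σ+hτ)ᵀ D²V]` is the Hessian quadratic form at the vector `σ + hτ`. -/
theorem stmt11 {N P : ℕ}
    (f σ τ : EuclideanSpace ℝ (Fin N) → EuclideanSpace ℝ (Fin N))
    (g : Fin P → EuclideanSpace ℝ (Fin N) → EuclideanSpace ℝ (Fin N))
    (V : EuclideanSpace ℝ (Fin N) → ℝ)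
    (l h γ β : EuclideanSpace ℝ (Fin N) → ℝ)
    (k : Fin P → EuclideanSpace ℝ (Fin N) → ℝ)
    (hf : Continuous f) (hσ : Continuous σ) (hτ : Continuous τ)
    (hg : ∀ i, Continuous (g i))
    (hV : ContDiffOn ℝ 2 V {x | x ≠ 0})
    (hl : ContinuousOn l {x | x ≠ 0})
    (hlpos : ∀ x : EuclideanSpace ℝ (Fin N), x ≠ 0 → 0 < l x)
    (hh : ContinuousOn h {x | x ≠ 0})
    (horth : ∀ x : EuclideanSpace ℝ (Fin N), x ≠ 0 →
      fderiv ℝ V x (σ x + h x • τ x) = 0)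
    (hγ : ∀ x, γ x = fderiv ℝ V x (f x)
      + (1/2) * iteratedFDeriv ℝ 2 V x ![σ x + h x • τ x, σ x + h x • τ x] + l x / 2)
    (hβ : ∀ x, β x = ∑ i, (fderiv ℝ V x (g i x)) ^ 2)
    (hγβ : ∀ x : EuclideanSpace ℝ (Fin N), x ≠ 0 → β x = 0 → γ x ≤ -(l x / 2))
    (hk : ∀ i x, k i x = -(phiS (γ x, β x) * fderiv ℝ V x (g i x))) :
    (∀ x : EuclideanSpace ℝ (Fin N), x ≠ 0 → (γ x, β x) ∈ Sset) ∧
    (∀ i, ContinuousOn (k i) {x | x ≠ 0}) ∧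
    (∀ x : EuclideanSpace ℝ (Fin N), x ≠ 0 →
      (fderiv ℝ V x (f x + ∑ i, k i x • g i x)
          + (1/2) * iteratedFDeriv ℝ 2 V x ![σ x + h x • τ x, σ x + h x • τ x] + l x / 2
          = -Real.sqrt (γ x ^ 2 + β x ^ 2)) ∧
      -Real.sqrt (γ x ^ 2 + β x ^ 2) < 0 ∧
      fderiv ℝ V x (f x + ∑ i, k i x • g i x)
          + (1/2) * iteratedFDeriv ℝ 2 V x ![σ x + h x • τ x, σ x + h x • τ x]
          ≤ -(l x / 2)) := by
  have hopen : IsOpen {x : EuclideanSpace ℝ (Fin N) | x ≠ 0} := isOpen_ne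
  have hS : ∀ x : EuclideanSpace ℝ (Fin N), x ≠ 0 → (γ x, β x) ∈ Sset := by
    intro x hx
    have hβ0 : 0 ≤ β x := hβ x ▸ Finset.sum_nonneg fun i _ => sq_nonneg _
    rcases hβ0.eq_or_lt with h0 | h0
    · exact Or.inr ((hγβ x hx h0.symm).trans_lt (by linarith [hlpos x hx]))
    · exact Or.inl h0
  have hDV : ContinuousOn (fderiv ℝ V) {x | x ≠ 0} :=
    hV.continuousOn_fderiv_of_isOpen hopen (by norm_num)
  have hD2V : ContinuousOn (fderiv ℝ (fderiv ℝ V)) {x | x ≠ 0} :=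
    (hV.fderiv_of_isOpen (m := 1) hopen (by norm_num)).continuousOn_fderiv_of_isOpen hopen le_rfl
  have hv : ContinuousOn (fun x => σ x + h x • τ x) {x | x ≠ 0} :=
    hσ.continuousOn.add (hh.smul hτ.continuousOn)
  have hgDV : ∀ i, ContinuousOn (fun x => fderiv ℝ V x (g i x)) {x | x ≠ 0} :=
    fun i => hDV.clm_apply (hg i).continuousOn
  have hγc : ContinuousOn γ {x | x ≠ 0} := by
    rw [funext hγ]
    simp only [iteratedFDeriv_two_apply, Matrix.cons_val_zero, Matrix.cons_val_one]
    exact ((hDV.clm_apply hf.continuousOn).add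
      (continuousOn_const.mul ((hD2V.clm_apply hv).clm_apply hv))).add (hl.div_const 2)
  have hβc : ContinuousOn β {x | x ≠ 0} := by
    rw [funext hβ]
    exact continuousOn_finsetSum _ fun i _ => (hgDV i).pow 2
  refine ⟨hS, fun i => ?_, fun x hx => ?_⟩
  · rw [funext (hk i)]
    exact ((continuousOn_phiS.comp (hγc.prodMk hβc) hS).mul (hgDV i)).neg
  · have hsum : fderiv ℝ V x (∑ i, k i x • g i x) = -(phiS (γ x, β x) * β x) := by
      rw [map_sum]
      conv_rhs => rw [hβ x, Finset.mul_sum, ← Finset.sum_neg_distrib]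
      refine Finset.sum_congr rfl fun i _ => ?_
      rw [map_smul, smul_eq_mul, hk i x, hβ x]
      ring
    have hid := sub_phiS_mul (hS x hx)
    have hpos := Real.sqrt_pos.2 (sq_add_sq_pos_of_mem_Sset (hS x hx))
    have hγx := hγ x
    simp only at hid hpos
    rw [map_add, hsum]
    exact ⟨by linarith, by linarith, by linarith⟩
end
end

section
/- Let A be a nonempty compact metric space, f : ℝ^N × A → ℝ^N and σ : ℝ^N × A → ℝ^{N×M} continuous, and a(x,α) := (1/2)σ(x,α)σ(x,α)^T. Let v : (0,∞) → ℝ be twice continuously differentiable with v′(r) > 0 for all r > 0, and set V(x) := v(|x|). Then for every x ≠ 0 the following are equivalent: (i) there exists ᾱ ∈ A with σ(x,ᾱ)^T x = 0 and −DV(x)·f(x,ᾱ) − trace(a(x,ᾱ)·D²V(x)) ≥ 0; (ii) there exists ᾱ ∈ A with σ(x,ᾱ)^T x = 0 and f(x,ᾱ)·x + trace(a(x,ᾱ)) ≤ 0. -/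
open scoped BigOperators

noncomputable section

/-- The derivative of a radial function away from the origin. -/
theorem hasFDerivAt_radial {E : Type*} [NormedAddCommGroup E] [InnerProductSpace ℝ E]
    {v : ℝ → ℝ} {y : E} (hy : y ≠ 0) (hv : DifferentiableAt ℝ v ‖y‖) :
    HasFDerivAt (fun z : E => v ‖z‖) ((deriv v ‖y‖ / ‖y‖) • innerSL ℝ y) y := by
  have hn : HasFDerivAt (fun z : E => ‖z‖) (‖y‖⁻¹ • innerSL ℝ y) y := by
    have h := (hasStrictFDerivAt_norm_sq y).hasFDerivAt.sqrt
      (by simpa using hy)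
    simp only [Real.sqrt_sq (norm_nonneg _)] at h
    refine h.congr_fderiv ?_
    ext z
    have : ‖y‖ ≠ 0 := norm_ne_zero_iff.mpr hy
    simp
    field_simp
  have h := hv.hasDerivAt.comp_hasFDerivAt y hn
  refine h.congr_fderiv ?_
  rw [smul_smul, div_eq_mul_inv]

/-- The gradient of a radial function away from the origin. -/
theorem gradient_radial {E : Type*} [NormedAddCommGroup E] [InnerProductSpace ℝ E]
    [CompleteSpace E] {v : ℝ → ℝ} {y : E} (hy : y ≠ 0) (hv : DifferentiableAt ℝ v ‖y‖) :
    gradient (fun z : E => v ‖z‖) y = (deriv v ‖y‖ / ‖y‖) • y := by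
  apply HasGradientAt.gradient
  rw [hasGradientAt_iff_hasFDerivAt]
  refine (hasFDerivAt_radial hy hv).congr_fderiv ?_
  ext z
  simp

/-- The Hessian of a radial function at `x ≠ 0` is a multiple of the identity plus a bilinear form
`(h, k) ↦ ℓ h * ⟪x, k⟫`. -/
theorem exists_iteratedFDeriv_two_radial {E : Type*} [NormedAddCommGroup E]
    [InnerProductSpace ℝ E] {v : ℝ → ℝ} (hv : ContDiffOn ℝ 2 v (Set.Ioi (0 : ℝ)))
    {x : E} (hx : x ≠ 0) :
    ∃ l : E →L[ℝ] ℝ, ∀ h k : E,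
      iteratedFDeriv ℝ 2 (fun y : E => v ‖y‖) x ![h, k] =
        (deriv v ‖x‖ / ‖x‖) * inner ℝ h k + l h * inner ℝ x k := by
  have hpos : 0 < ‖x‖ := norm_pos_iff.mpr hx
  have hd : DifferentiableAt ℝ (fun y : E => deriv v ‖y‖ / ‖y‖) x := by
    have hdv : DifferentiableAt ℝ (deriv v) ‖x‖ :=
      ((hv.deriv_of_isOpen (m := 1) isOpen_Ioi (by norm_num)).differentiableOn
        one_ne_zero).differentiableAt (Ioi_mem_nhds hpos)
    have hn : DifferentiableAt ℝ (fun y : E => ‖y‖) x := differentiableAt_id.norm ℝ hx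
    simp only [div_eq_mul_inv]
    exact (hdv.comp (g := deriv v) x hn).fun_mul (hn.fun_inv hpos.ne')
  have heq : fderiv ℝ (fun y : E => v ‖y‖) =ᶠ[nhds x]
      fun y => (deriv v ‖y‖ / ‖y‖) • innerSL ℝ y := by
    filter_upwards [isOpen_ne.mem_nhds hx] with y hy
    exact (hasFDerivAt_radial hy ((hv.differentiableOn two_ne_zero).differentiableAt
      (Ioi_mem_nhds (norm_pos_iff.mpr hy)))).fderiv
  refine ⟨fderiv ℝ (fun y : E => deriv v ‖y‖ / ‖y‖) x, fun h k => ?_⟩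
  have hs := hd.hasFDerivAt.fun_smul (innerSL ℝ (E := E)).hasFDerivAt
  rw [iteratedFDeriv_two_apply, heq.fderiv_eq, hs.fderiv]
  rfl

/-- If `σᵀ x = 0`, then a Hessian of the form `g • 1 + l xᵀ` only contributes `g * trace a`. -/
theorem trace_aMat_mul {N M : ℕ} {σ : Matrix (Fin N) (Fin M) ℝ} {x : Fin N → ℝ}
    (h : σ.transpose.mulVec x = 0) (g : ℝ) (l : Fin N → ℝ) :
    (aMat σ * (g • 1 + Matrix.vecMulVec l x)).trace = g * (aMat σ).trace := by
  have hx : Matrix.vecMul x (aMat σ) = 0 := by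
    rw [aMat, Matrix.vecMul_smul, ← Matrix.vecMul_vecMul, ← Matrix.mulVec_transpose σ, h,
      Matrix.zero_vecMul, smul_zero]
  rw [mul_add, Matrix.trace_add, Matrix.trace_mul_comm (aMat σ) (Matrix.vecMulVec l x),
    Matrix.vecMulVec_mul, hx]
  simp

/-- for a radial function `V(x) = v(|x|)` with `v' > 0`, at every `x ≠ 0`
the Lyapunov decrease condition restricted to controls with `σ(x,α)ᵀx = 0` is equivalent to
`f(x,ᾱ)·x + trace(a(x,ᾱ)) ≤ 0` for some such control. Here `DV(x)` is the gradient of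
`y ↦ v(|y|)` and `D²V(x)` the Hessian matrix `H` with entries `H i j = D²V(x)[eᵢ,eⱼ]`. -/
theorem stmt15 {N M : ℕ} {A : Type*} [MetricSpace A] [CompactSpace A] [Nonempty A]
    (f : EuclideanSpace ℝ (Fin N) → A → EuclideanSpace ℝ (Fin N))
    (σ : EuclideanSpace ℝ (Fin N) → A → Matrix (Fin N) (Fin M) ℝ)
    (hf : Continuous fun q : EuclideanSpace ℝ (Fin N) × A => f q.1 q.2)
    (hσ : Continuous fun q : EuclideanSpace ℝ (Fin N) × A => σ q.1 q.2)
    (v : ℝ → ℝ) (hv : ContDiffOn ℝ 2 v (Set.Ioi (0 : ℝ)))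
    (hv' : ∀ r : ℝ, 0 < r → 0 < deriv v r)
    (x : EuclideanSpace ℝ (Fin N)) (hx : x ≠ 0)
    (H : Matrix (Fin N) (Fin N) ℝ)
    (hH : ∀ i j, H i j = iteratedFDeriv ℝ 2 (fun y : EuclideanSpace ℝ (Fin N) => v ‖y‖) x
      ![EuclideanSpace.single i 1, EuclideanSpace.single j 1]) :
    ((∃ α : A, (σ x α).transpose.mulVec (fun i => x i) = 0 ∧
        0 ≤ -dotP (gradient (fun y : EuclideanSpace ℝ (Fin N) => v ‖y‖) x) (f x α)
          - (aMat (σ x α) * H).trace) ↔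
      (∃ α : A, (σ x α).transpose.mulVec (fun i => x i) = 0 ∧
        dotP (f x α) x + (aMat (σ x α)).trace ≤ 0)) := by
  have hpos : 0 < ‖x‖ := norm_pos_iff.mpr hx
  have hg : 0 < deriv v ‖x‖ / ‖x‖ := div_pos (hv' _ hpos) hpos
  obtain ⟨l, hl⟩ := exists_iteratedFDeriv_two_radial hv hx
  have hH' : H = (deriv v ‖x‖ / ‖x‖) • 1 +
      Matrix.vecMulVec (fun i => l (EuclideanSpace.single i 1)) (fun i => x i) := by
    ext i j
    rw [hH, hl]
    simp [Matrix.vecMulVec_apply, Matrix.one_apply, EuclideanSpace.inner_single_right,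
      eq_comm]
  have hgrad := gradient_radial hx
    ((hv.differentiableOn two_ne_zero).differentiableAt (Ioi_mem_nhds hpos))
  refine exists_congr fun α => and_congr_right fun h => ?_
  have hdot : dotP ((deriv v ‖x‖ / ‖x‖) • x) (f x α) =
      deriv v ‖x‖ / ‖x‖ * dotP (f x α) x := by
    simp only [dotP, Finset.mul_sum, PiLp.smul_apply, smul_eq_mul]
    exact Finset.sum_congr rfl fun i _ => by ring
  rw [hgrad, hdot, hH', trace_aMat_mul h, ← neg_add', ← mul_add, neg_nonneg,
    ← smul_eq_mul, smul_nonpos_iff_nonpos_of_pos_left hg]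
end
end
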